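/- arXiv:2305.14329 — 6 statements merged into one kernel-verified Lean document; each statement's English description precedes it below -/
import Mathlib

section
/- Let Γ be a two-player zero-sum finite-horizon Markov game (n = 2 and r_{2,h}(s,a) = −r_{1,h}(s,a) for all h, s, a), let ε ≥ 0, and let σ be an ε-approximate CCE of Γ. Then the marginal product policy π^σ = π₁^σ × π₂^σ is a 2ε-approximate NE of Γ. -/
open Finset

section FiniteHorizon

variable {n : ℕ} {S : Type*} [Fintype S] {A : Fin n → Type*}
  [∀ k, Fintype (A k)] [∀ k, DecidableEq (A k)]

/-- `f` is a probability distribution on the finite type `α`. -/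
def IsDist {α : Type*} [Fintype α] (f : α → ℝ) : Prop :=
  (∀ x, 0 ≤ f x) ∧ ∑ x, f x = 1

/-- A (nonstationary) Markov policy over horizon `H`: a distribution on `α`
for every timestep `h < H` (`h` is 0-indexed) and state `s`. -/
def IsPol {S : Type*} {α : Type*} [Fintype α] (H : ℕ) (π : ℕ → S → α → ℝ) : Prop :=
  ∀ h, h < H → ∀ s : S, IsDist (π h s)

/-- A valid transition kernel over horizon `H`. -/
def IsKernel (H : ℕ) (P : ℕ → S → (∀ k, A k) → S → ℝ) : Prop :=
  ∀ h, h < H → ∀ s a, IsDist (P h s a)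

/-- Rewards take values in `[-1, 1]`. -/
def IsReward (H : ℕ) (r : Fin n → ℕ → S → (∀ k, A k) → ℝ) : Prop :=
  ∀ k, ∀ h, h < H → ∀ s a, r k h s a ∈ Set.Icc (-1 : ℝ) 1

/-- Value with `t` remaining steps, current timestep `h` (0-indexed), state `s`,
under joint (possibly correlated) policy `σ`, reward function `rk` and kernel `P`. -/
noncomputable def valAux (P : ℕ → S → (∀ k, A k) → S → ℝ)
    (rk : ℕ → S → (∀ k, A k) → ℝ) (σ : ℕ → S → (∀ k, A k) → ℝ) :
    ℕ → ℕ → S → ℝ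
  | 0, _, _ => 0
  | t + 1, h, s =>
      ∑ a, σ h s a * (rk h s a + ∑ s', P h s a s' * valAux P rk σ t (h + 1) s')

/-- `val H P rk σ h s` is the expected total reward `V^σ_{h}(s)` accumulated from
timestep `h` (0-indexed; the paper's `h+1`) up to the horizon `H`. -/
noncomputable def val (H : ℕ) (P : ℕ → S → (∀ k, A k) → S → ℝ)
    (rk : ℕ → S → (∀ k, A k) → ℝ) (σ : ℕ → S → (∀ k, A k) → ℝ)
    (h : ℕ) (s : S) : ℝ :=
  valAux P rk σ (H - h) h s

/-- The joint policy in which player `k` plays `π'` independently against the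
marginal `σ₋ₖ` of the joint policy `σ`. -/
noncomputable def deviate (k : Fin n) (π' : ℕ → S → A k → ℝ)
    (σ : ℕ → S → (∀ j, A j) → ℝ) : ℕ → S → (∀ j, A j) → ℝ :=
  fun h s a => π' h s (a k) * ∑ b : A k, σ h s (Function.update a k b)

/-- The marginal policy of player `k` induced by a joint policy `σ`. -/
noncomputable def marginal (σ : ℕ → S → (∀ j, A j) → ℝ) (k : Fin n) :
    ℕ → S → A k → ℝ :=
  fun h s b => ∑ a : ∀ j, A j, if a k = b then σ h s a else 0

/-- The product policy induced by individual policies `π k`. -/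
def prodPol (π : ∀ k, ℕ → S → A k → ℝ) : ℕ → S → (∀ j, A j) → ℝ :=
  fun h s a => ∏ k, π k h s (a k)

/-- `σ` is an `ε`-approximate coarse correlated equilibrium:
no unilateral (Markov-policy) deviation gains more than `ε`. -/
def IsCCE (H : ℕ) (P : ℕ → S → (∀ k, A k) → S → ℝ)
    (r : Fin n → ℕ → S → (∀ k, A k) → ℝ) (s₁ : S) (ε : ℝ)
    (σ : ℕ → S → (∀ k, A k) → ℝ) : Prop :=
  ∀ k : Fin n, ∀ π' : ℕ → S → A k → ℝ, IsPol H π' →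
    val H P (r k) (deviate k π' σ) 0 s₁ - val H P (r k) σ 0 s₁ ≤ ε

/-- The product policy `π` is an `ε`-approximate Nash equilibrium. -/
def IsNE (H : ℕ) (P : ℕ → S → (∀ k, A k) → S → ℝ)
    (r : Fin n → ℕ → S → (∀ k, A k) → ℝ) (s₁ : S) (ε : ℝ)
    (π : ∀ k, ℕ → S → A k → ℝ) : Prop :=
  ∀ k : Fin n, ∀ π' : ℕ → S → A k → ℝ, IsPol H π' →
    val H P (r k) (deviate k π' (prodPol π)) 0 s₁ -
      val H P (r k) (prodPol π) 0 s₁ ≤ ε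

/-- `v` is the best-response value `V^{†,σ₋ₖ}_{k,h}(s)` of player `k` against the
joint policy `σ` from timestep `h` and state `s`. -/
def IsBRVal (H : ℕ) (P : ℕ → S → (∀ k, A k) → S → ℝ)
    (rk : ℕ → S → (∀ k, A k) → ℝ) (σ : ℕ → S → (∀ k, A k) → ℝ)
    (k : Fin n) (h : ℕ) (s : S) (v : ℝ) : Prop :=
  IsGreatest {x : ℝ | ∃ π' : ℕ → S → A k → ℝ, IsPol H π' ∧
    x = val H P rk (deviate k π' σ) h s} v

/-- The game is zero-sum polymatrix: rewards sum to zero at every state and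
joint action, and each player's reward decomposes into pairwise payoffs
(each valued in `[-1, 1]`) with the other players. -/
def IsZSPolymatrix (H : ℕ) (r : Fin n → ℕ → S → (∀ k, A k) → ℝ) : Prop :=
  (∀ h, h < H → ∀ s a, ∑ k, r k h s a = 0) ∧
  ∃ q : (k : Fin n) → (j : Fin n) → ℕ → S → A k → A j → ℝ,
    (∀ k j h s x y, q k j h s x y ∈ Set.Icc (-1 : ℝ) 1) ∧
    ∀ k, ∀ h, h < H → ∀ s a,
      r k h s a = ∑ j ∈ univ.filter (fun j => j ≠ k), q k j h s (a k) (a j)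

/-- Switching control: at every state a single player (possibly depending on
the state) controls the transition. -/
def SwitchingControl (H : ℕ) (P : ℕ → S → (∀ k, A k) → S → ℝ) : Prop :=
  ∀ s : S, ∃ k : Fin n, ∀ h, h < H → ∀ a a' : ∀ j, A j, a k = a' k → P h s a = P h s a'

/-- Feasibility for the nonlinear program `P_NE` (with the terminal condition
`w k H s = 0`, 0-indexed timesteps). -/
def FeasNE (H : ℕ) (P : ℕ → S → (∀ k, A k) → S → ℝ)
    (r : Fin n → ℕ → S → (∀ k, A k) → ℝ)
    (π : ∀ k, ℕ → S → A k → ℝ) (w : Fin n → ℕ → S → ℝ) : Prop :=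
  (∀ k, IsPol H (π k)) ∧ (∀ k s, w k H s = 0) ∧
  ∀ k : Fin n, ∀ h, h < H → ∀ s, ∀ b : A k,
    (∑ a : ∀ j, A j, if a k = b then
        (∏ j ∈ univ.filter (fun j => j ≠ k), π j h s (a j)) *
          (r k h s a + ∑ s', P h s a s' * w k (h + 1) s')
      else 0) ≤ w k h s

/-- Objective of the nonlinear program `P_NE`. -/
noncomputable def objNE (H : ℕ) (P : ℕ → S → (∀ k, A k) → S → ℝ)
    (r : Fin n → ℕ → S → (∀ k, A k) → ℝ) (s₁ : S)
    (π : ∀ k, ℕ → S → A k → ℝ) (w : Fin n → ℕ → S → ℝ) : ℝ :=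
  ∑ k, (w k 0 s₁ - val H P (r k) (prodPol π) 0 s₁)

/-- Feasibility for the best-response linear program `P_BR(σ̂)`. -/
def FeasBR (H : ℕ) (P : ℕ → S → (∀ k, A k) → S → ℝ)
    (r : Fin n → ℕ → S → (∀ k, A k) → ℝ)
    (σ' : ℕ → S → (∀ k, A k) → ℝ) (w : Fin n → ℕ → S → ℝ) : Prop :=
  (∀ k s, w k H s = 0) ∧
  ∀ k : Fin n, ∀ h, h < H → ∀ s, ∀ b : A k,
    (∑ a : ∀ j, A j, if a k = b then
        (∑ b' : A k, σ' h s (Function.update a k b')) *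
          (r k h s a + ∑ s', P h s a s' * w k (h + 1) s')
      else 0) ≤ w k h s

/-- Objective of the best-response linear program `P_BR(σ̂)`. -/
noncomputable def objBR (H : ℕ) (P : ℕ → S → (∀ k, A k) → S → ℝ)
    (r : Fin n → ℕ → S → (∀ k, A k) → ℝ) (s₁ : S)
    (σ' : ℕ → S → (∀ k, A k) → ℝ) (w : Fin n → ℕ → S → ℝ) : ℝ :=
  ∑ k, (w k 0 s₁ - val H P (r k) σ' 0 s₁)

end FiniteHorizon

theorem valAux_congr {n : ℕ} {S : Type*} [Fintype S] {A : Fin n → Type*} [∀ k, Fintype (A k)]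
    [∀ k, DecidableEq (A k)] {H : ℕ} (P : ℕ → S → (∀ k, A k) → S → ℝ)
    (rk : ℕ → S → (∀ k, A k) → ℝ) {σ τ : ℕ → S → (∀ k, A k) → ℝ}
    (hστ : ∀ h, h < H → ∀ s a, σ h s a = τ h s a) (t h : ℕ) (hth : h + t ≤ H) (s : S) :
    valAux P rk σ t h s = valAux P rk τ t h s := by
  induction t generalizing h s with
  | zero => rfl
  | succ t ih =>
    simp only [valAux]
    refine Finset.sum_congr rfl fun a _ => ?_
    rw [hστ h (by omega)]
    simp only [ih (h + 1) (by omega)]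

theorem valAux_neg {n : ℕ} {S : Type*} [Fintype S] {A : Fin n → Type*} [∀ k, Fintype (A k)]
    [∀ k, DecidableEq (A k)] {H : ℕ} (P : ℕ → S → (∀ k, A k) → S → ℝ)
    {rk rj : ℕ → S → (∀ k, A k) → ℝ} (σ : ℕ → S → (∀ k, A k) → ℝ)
    (hr : ∀ h, h < H → ∀ s a, rj h s a = -rk h s a) (t h : ℕ) (hth : h + t ≤ H) (s : S) :
    valAux P rj σ t h s = -valAux P rk σ t h s := by
  induction t generalizing h s with
  | zero => simp [valAux]
  | succ t ih =>
    simp only [valAux]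
    rw [← Finset.sum_neg_distrib]
    refine Finset.sum_congr rfl fun a _ => ?_
    rw [hr h (by omega)]
    simp only [ih (h + 1) (by omega), mul_neg, Finset.sum_neg_distrib]
    ring

theorem isPol_marginal {n : ℕ} {S : Type*} {A : Fin n → Type*} [∀ k, Fintype (A k)]
    [∀ k, DecidableEq (A k)] {H : ℕ} {σ : ℕ → S → (∀ k, A k) → ℝ} (hσ : IsPol H σ)
    (k : Fin n) : IsPol H (marginal σ k) := by
  intro h hh s
  refine ⟨fun b => Finset.sum_nonneg fun a _ => ?_, ?_⟩
  · split_ifs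
    · exact (hσ h hh s).1 a
    · exact le_rfl
  · simp only [marginal]
    rw [Finset.sum_comm]
    simpa using (hσ h hh s).2

/-- With only two players, summing out player `k` leaves the marginal of the other player. -/
theorem sum_update_eq_marginal {S : Type*} {A : Fin 2 → Type*} [∀ k, Fintype (A k)]
    [∀ k, DecidableEq (A k)] (σ : ℕ → S → (∀ k, A k) → ℝ) {k j : Fin 2} (hkj : k ≠ j)
    (h : ℕ) (s : S) (a : ∀ k, A k) :
    ∑ b : A k, σ h s (Function.update a k b) = marginal σ j h s (a j) := by
  rw [marginal, ← Finset.sum_filter]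
  refine Finset.sum_nbij' (fun b => Function.update a k b) (fun a' => a' k) ?_ ?_ ?_ ?_ ?_
  · simp [hkj.symm]
  · simp
  · simp
  · intro a' ha'
    have ha' : a' j = a j := by simpa using ha'
    funext i
    obtain rfl | rfl : i = k ∨ i = j := by omega
    · simp
    · simp [hkj.symm, ha']
  · simp

theorem deviate_eq_mul_marginal {S : Type*} {A : Fin 2 → Type*}
    [∀ k, Fintype (A k)] [∀ k, DecidableEq (A k)] (σ : ℕ → S → (∀ k, A k) → ℝ) {k j : Fin 2}
    (hkj : k ≠ j) (π' : ℕ → S → A k → ℝ) (h : ℕ) (s : S) (a : ∀ k, A k) :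
    deviate k π' σ h s a = π' h s (a k) * marginal σ j h s (a j) := by
  rw [deviate, sum_update_eq_marginal σ hkj]

theorem prodPol_fin_two {S : Type*} {A : Fin 2 → Type*} (π : ∀ k, ℕ → S → A k → ℝ)
    {k j : Fin 2} (hkj : k ≠ j) (h : ℕ) (s : S) (a : ∀ k, A k) :
    prodPol π h s a = π k h s (a k) * π j h s (a j) := by
  have huniv : (Finset.univ : Finset (Fin 2)) = {k, j} := by
    ext i
    simp only [Finset.mem_univ, Finset.mem_insert, Finset.mem_singleton, true_iff]
    omega
  rw [prodPol, huniv, Finset.prod_pair hkj]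

theorem deviate_prodPol_marginal {S : Type*} {A : Fin 2 → Type*} [∀ k, Fintype (A k)]
    [∀ k, DecidableEq (A k)] {H : ℕ} {σ : ℕ → S → (∀ k, A k) → ℝ} (hσ : IsPol H σ) {k j : Fin 2}
    (hkj : k ≠ j) (π' : ℕ → S → A k → ℝ) {h : ℕ} (hh : h < H) (s : S) (a : ∀ k, A k) :
    deviate k π' (prodPol fun i => marginal σ i) h s a = deviate k π' σ h s a := by
  rw [deviate_eq_mul_marginal σ hkj, deviate]
  congr 1
  simp only [prodPol_fin_two _ hkj, Function.update_self, Function.update_of_ne hkj.symm]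
  rw [← Finset.sum_mul, (isPol_marginal hσ k h hh s).2, one_mul]

theorem cce_collapse_two_player_zero_sum
    {S : Type*} [Fintype S] {A : Fin 2 → Type*}
    [∀ k, Fintype (A k)] [∀ k, DecidableEq (A k)]
    (H : ℕ) (P : ℕ → S → (∀ k, A k) → S → ℝ)
    (r : Fin 2 → ℕ → S → (∀ k, A k) → ℝ) (s₁ : S) (ε : ℝ)
    (σ : ℕ → S → (∀ k, A k) → ℝ)
    (hP : IsKernel H P) (hr : IsReward H r)
    (hzs : ∀ h, h < H → ∀ s a, r 1 h s a = - r 0 h s a)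
    (hε : 0 ≤ ε) (hσ : IsPol H σ) (hCCE : IsCCE H P r s₁ ε σ) :
    IsNE H P r s₁ (2 * ε) (fun k => marginal σ k) := by
  intro k π' hπ'
  obtain ⟨j, hkj, hjk⟩ : ∃ j, k ≠ j ∧ ∀ h, h < H → ∀ s a, r j h s a = -r k h s a := by
    obtain rfl | rfl : k = 0 ∨ k = 1 := by omega
    · exact ⟨1, by decide, hzs⟩
    · exact ⟨0, by decide, fun h hh s a => by rw [hzs h hh, neg_neg]⟩
  have hdev : val H P (r k) (deviate k π' (prodPol fun i => marginal σ i)) 0 s₁ =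
      val H P (r k) (deviate k π' σ) 0 s₁ :=
    valAux_congr P _ (fun h hh s a => deviate_prodPol_marginal hσ hkj π' hh s a) _ _ (by omega) _
  have hprod : val H P (r j) (deviate j (marginal σ j) σ) 0 s₁ =
      val H P (r j) (prodPol fun i => marginal σ i) 0 s₁ :=
    valAux_congr (H := H) P _ (fun h _ s a => by
      rw [deviate_eq_mul_marginal σ hkj.symm, prodPol_fin_two _ hkj.symm]) _ _ (by omega) _
  have hneg : ∀ τ, val H P (r j) τ 0 s₁ = -val H P (r k) τ 0 s₁ := fun τ =>
    valAux_neg P τ hjk _ _ (by omega) _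
  have hk := hCCE k π' hπ'
  have hj := hCCE j (marginal σ j) (isPol_marginal hσ j)
  rw [hprod, hneg, hneg] at hj
  rw [hdev]
  linarith
end

section
/- Let Γ be a finite-horizon zero-sum polymatrix switching-control Markov game and ε ≥ 0. If (π*, w*) is a feasible point of P_NE whose objective value is at most ε (an ε-approximate global minimum, since the global minimum equals 0), then π* is an nε-approximate NE of Γ (indeed even an ε-approximate NE). Conversely, if π* is an ε-approximate NE of Γ and w* is the vector of best-response values w*_{k,h}(s) = V^{†,π*_{−k}}_{k,h}(s) for all k, h, s, then (π*, w*) is feasible for P_NE and attains an nε-approximate global minimum. -/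
open Finset

section BestResponse

variable {n : ℕ} {S : Type*} {A : Fin n → Type*}

theorem prodPol_update (π : ∀ k, ℕ → S → A k → ℝ) (k : Fin n) (h : ℕ) (s : S)
    (a : ∀ j, A j) (b : A k) :
    prodPol π h s (Function.update a k b) =
      π k h s b * ∏ j ∈ univ.filter (fun j => j ≠ k), π j h s (a j) := by
  unfold prodPol
  rw [Finset.filter_ne' univ k, ← Finset.mul_prod_erase univ _ (mem_univ k)]
  congr 1
  · simp
  · refine Finset.prod_congr rfl fun j hj => ?_
    rw [Function.update_of_ne (Finset.ne_of_mem_erase hj)]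

variable [∀ k, Fintype (A k)]

theorem deviate_prodPol {H : ℕ} {π : ∀ k, ℕ → S → A k → ℝ} {k : Fin n}
    (hπ : IsPol H (π k)) (π' : ℕ → S → A k → ℝ) {h : ℕ} (hh : h < H) (s : S) (a : ∀ j, A j) :
    deviate k π' (prodPol π) h s a =
      π' h s (a k) * ∏ j ∈ univ.filter (fun j => j ≠ k), π j h s (a j) := by
  simp only [deviate, prodPol_update]
  rw [← Finset.sum_mul, (hπ h hh s).2, one_mul]

/-- Deviating to one's own policy does not change a product policy. -/
theorem deviate_prodPol_self {H : ℕ} {π : ∀ k, ℕ → S → A k → ℝ} {k : Fin n}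
    (hπ : IsPol H (π k)) {h : ℕ} (hh : h < H) (s : S) (a : ∀ j, A j) :
    deviate k (π k) (prodPol π) h s a = prodPol π h s a := by
  rw [deviate_prodPol hπ _ hh, ← prodPol_update, Function.update_eq_self]

theorem deviate_prodPol_nonneg {H : ℕ} {π : ∀ k, ℕ → S → A k → ℝ} (hπ : ∀ k, IsPol H (π k))
    {k : Fin n} {π' : ℕ → S → A k → ℝ} (hπ' : IsPol H π') {h : ℕ} (hh : h < H) (s : S)
    (a : ∀ j, A j) : 0 ≤ deviate k π' (prodPol π) h s a := by
  rw [deviate_prodPol (hπ k) _ hh]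
  exact mul_nonneg ((hπ' h hh s).1 _) (Finset.prod_nonneg fun j _ => (hπ j h hh s).1 _)

/-- The expectation under a deviation is the average, over the actions of the deviator, of the
conditional expectations against the other players. -/
theorem sum_deviate_prodPol [∀ k, DecidableEq (A k)] {H : ℕ}
    {π : ∀ k, ℕ → S → A k → ℝ} {k : Fin n} (hπ : IsPol H (π k)) (π' : ℕ → S → A k → ℝ)
    {h : ℕ} (hh : h < H) (s : S) (F : (∀ j, A j) → ℝ) :
    ∑ a, deviate k π' (prodPol π) h s a * F a =
      ∑ b, π' h s b * ∑ a : ∀ j, A j, if a k = b then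
        (∏ j ∈ univ.filter (fun j => j ≠ k), π j h s (a j)) * F a else 0 := by
  simp only [Finset.mul_sum]
  rw [Finset.sum_comm]
  refine Finset.sum_congr rfl fun a _ => ?_
  simp [deviate_prodPol hπ π' hh, mul_assoc]

variable [Fintype S]

theorem val_horizon (H : ℕ) (P : ℕ → S → (∀ k, A k) → S → ℝ)
    (rk : ℕ → S → (∀ k, A k) → ℝ) (σ : ℕ → S → (∀ k, A k) → ℝ) (s : S) :
    val H P rk σ H s = 0 := by
  simp [_root_.val, valAux]

theorem val_of_lt {H : ℕ} (P : ℕ → S → (∀ k, A k) → S → ℝ)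
    (rk : ℕ → S → (∀ k, A k) → ℝ) (σ : ℕ → S → (∀ k, A k) → ℝ) {h : ℕ} (hh : h < H) (s : S) :
    val H P rk σ h s =
      ∑ a, σ h s a * (rk h s a + ∑ s', P h s a s' * val H P rk σ (h + 1) s') := by
  obtain ⟨t, ht⟩ : ∃ t, H - h = t + 1 := ⟨H - h - 1, by omega⟩
  have ht' : H - (h + 1) = t := by omega
  simp [_root_.val, ht, ht', valAux]

theorem val_congr {H : ℕ} (P : ℕ → S → (∀ k, A k) → S → ℝ)
    (rk : ℕ → S → (∀ k, A k) → ℝ) {σ τ : ℕ → S → (∀ k, A k) → ℝ}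
    (hστ : ∀ h, h < H → ∀ s a, σ h s a = τ h s a) {h : ℕ} (hh : h ≤ H) :
    ∀ s, val H P rk σ h s = val H P rk τ h s := by
  induction hh using Nat.decreasingInduction with
  | self => simp [val_horizon]
  | of_succ h hh ih =>
    intro s
    simp [val_of_lt _ _ _ hh, ih, hστ h hh]

/-- Monotonicity of the one-step expectation in the continuation values. -/
theorem sum_policy_mul_le {H : ℕ} {P : ℕ → S → (∀ k, A k) → S → ℝ} (hP : IsKernel H P)
    (rk : ℕ → S → (∀ k, A k) → ℝ) {h : ℕ} (hh : h < H) (s : S) {p : (∀ k, A k) → ℝ}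
    (hp : ∀ a, 0 ≤ p a) {v w : S → ℝ} (hvw : ∀ s, v s ≤ w s) :
    ∑ a, p a * (rk h s a + ∑ s', P h s a s' * v s') ≤
      ∑ a, p a * (rk h s a + ∑ s', P h s a s' * w s') := by
  gcongr with a _ s' _
  · exact hp a
  · exact (hP h hh s a).1 s'
  · exact hvw s'

/-- The values in a feasible point dominate the value of every deviation. -/
theorem FeasNE.val_deviate_le [∀ k, DecidableEq (A k)] {H : ℕ}
    {P : ℕ → S → (∀ k, A k) → S → ℝ} (hP : IsKernel H P)
    {r : Fin n → ℕ → S → (∀ k, A k) → ℝ} {π : ∀ k, ℕ → S → A k → ℝ} {w : Fin n → ℕ → S → ℝ}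
    (hw : FeasNE H P r π w) {k : Fin n} {π' : ℕ → S → A k → ℝ} (hπ' : IsPol H π')
    {h : ℕ} (hh : h ≤ H) :
    ∀ s, val H P (r k) (deviate k π' (prodPol π)) h s ≤ w k h s := by
  induction hh using Nat.decreasingInduction with
  | self => simp [val_horizon, hw.2.1]
  | of_succ h hh ih =>
    intro s
    rw [val_of_lt _ _ _ hh]
    refine (sum_policy_mul_le hP _ hh s (deviate_prodPol_nonneg hw.1 hπ' hh s) ih).trans ?_
    rw [sum_deviate_prodPol (hw.1 k) _ hh]
    calc _ ≤ ∑ b, π' h s b * w k h s := by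
          gcongr with b _
          · exact (hπ' h hh s).1 b
          · exact hw.2.2 k h hh s b
      _ = w k h s := by rw [← Finset.sum_mul, (hπ' h hh s).2, one_mul]

/-- A deviation that at each timestep and state, from `h₀` on, plays as some policy attaining the
best-response value there does at least as well as the best-response values. -/
theorem le_val_deviate_of_attaining {H : ℕ} {P : ℕ → S → (∀ k, A k) → S → ℝ}
    (hP : IsKernel H P) {rk : ℕ → S → (∀ k, A k) → ℝ} {π : ∀ k, ℕ → S → A k → ℝ}
    (hπ : ∀ k, IsPol H (π k)) {k : Fin n} {w : ℕ → S → ℝ}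
    (hw : ∀ h, h ≤ H → ∀ s, IsBRVal H P rk (prodPol π) k h s (w h s))
    {β : ℕ → S → ℕ → S → A k → ℝ} (hβ : ∀ h, h ≤ H → ∀ s, IsPol H (β h s))
    (hβw : ∀ h, h ≤ H → ∀ s, w h s = val H P rk (deviate k (β h s) (prodPol π)) h s)
    {h₀ : ℕ} {ρ : ℕ → S → A k → ℝ} (hρ : ∀ h, h₀ ≤ h → ∀ s, ρ h s = β h s h s)
    {h : ℕ} (hh : h ≤ H) :
    h₀ ≤ h → ∀ s, w h s ≤ val H P rk (deviate k ρ (prodPol π)) h s := by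
  induction hh using Nat.decreasingInduction with
  | self => intro _ s; rw [hβw H le_rfl, val_horizon, val_horizon]
  | of_succ h hh ih =>
    intro h₀h s
    rw [hβw h hh.le, val_of_lt _ _ _ hh, val_of_lt _ _ _ hh]
    have heq : ∀ a, deviate k ρ (prodPol π) h s a = deviate k (β h s) (prodPol π) h s a :=
      fun a => by simp [deviate, hρ h h₀h]
    simp only [heq]
    refine sum_policy_mul_le hP _ hh s
      (deviate_prodPol_nonneg hπ (hβ h hh.le s) hh s) fun s' => ?_
    exact ((hw (h + 1) hh s').2 ⟨_, hβ h hh.le s, rfl⟩).trans (ih (by omega) s')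

/-- The best-response values form a feasible point of `P_NE`. -/
theorem feasNE_of_isBRVal [∀ k, DecidableEq (A k)] {H : ℕ}
    {P : ℕ → S → (∀ k, A k) → S → ℝ} (hP : IsKernel H P)
    {r : Fin n → ℕ → S → (∀ k, A k) → ℝ} {π : ∀ k, ℕ → S → A k → ℝ}
    (hπ : ∀ k, IsPol H (π k)) {w : Fin n → ℕ → S → ℝ}
    (hw : ∀ k : Fin n, ∀ h, h ≤ H → ∀ s,
      IsBRVal H P (r k) (prodPol π) k h s (w k h s)) :
    FeasNE H P r π w := by
  refine ⟨hπ, fun k s => ?_, fun k h hh s b => ?_⟩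
  · obtain ⟨π', -, hπ'⟩ := (hw k H le_rfl s).1
    rw [hπ', val_horizon]
  have hex : ∀ t : ℕ, ∀ x : S, ∃ π' : ℕ → S → A k → ℝ, t ≤ H →
      IsPol H π' ∧ w k t x = val H P (r k) (deviate k π' (prodPol π)) t x := fun t x => by
    by_cases ht : t ≤ H
    · obtain ⟨π', h₁, h₂⟩ := (hw k t ht x).1
      exact ⟨π', fun _ => ⟨h₁, h₂⟩⟩
    · exact ⟨π k, fun h => absurd h ht⟩
  choose β hβ using hex
  set ρ : ℕ → S → A k → ℝ := fun t x =>
    if t = h then (fun c => if c = b then 1 else 0) else β t x t x with hρdef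
  have hρ : IsPol H ρ := fun t ht x => by
    by_cases hth : t = h
    · simp only [hρdef, hth, if_true]
      exact ⟨fun c => by dsimp only; split_ifs <;> norm_num, by simp⟩
    · simp only [hρdef, hth, if_false]
      exact (hβ t x ht.le).1 t ht x
  have hle := le_val_deviate_of_attaining hP hπ (hw k) (fun t ht x => (hβ t x ht).1)
    (fun t ht x => (hβ t x ht).2) (h₀ := h + 1) (ρ := ρ)
    (fun t ht x => by simp [hρdef, show t ≠ h by omega]) hh le_rfl
  refine le_trans ?_ ((hw k h hh.le s).2 ⟨ρ, hρ, rfl⟩)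
  rw [val_of_lt _ _ _ hh]
  refine le_trans ?_ (sum_policy_mul_le hP _ hh s (deviate_prodPol_nonneg hπ hρ hh s) hle)
  rw [sum_deviate_prodPol (hπ k) _ hh]
  simp [hρdef]

end BestResponse

theorem PNE_optimum_iff_NE
    {n : ℕ} {S : Type*} [Fintype S] {A : Fin n → Type*}
    [∀ k, Fintype (A k)] [∀ k, DecidableEq (A k)]
    (H : ℕ) (P : ℕ → S → (∀ k, A k) → S → ℝ)
    (r : Fin n → ℕ → S → (∀ k, A k) → ℝ) (s₁ : S) (ε : ℝ)
    (hP : IsKernel H P) (hr : IsReward H r)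
    (hzs : IsZSPolymatrix H r) (hsc : SwitchingControl H P) (hε : 0 ≤ ε) :
    (∀ π w, FeasNE H P r π w → objNE H P r s₁ π w ≤ ε →
      IsNE H P r s₁ ε π ∧ IsNE H P r s₁ ((n : ℝ) * ε) π) ∧
    (∀ π w, (∀ k, IsPol H (π k)) → IsNE H P r s₁ ε π →
      (∀ k : Fin n, ∀ h, h ≤ H → ∀ s,
        IsBRVal H P (r k) (prodPol π) k h s (w k h s)) →
      FeasNE H P r π w ∧ objNE H P r s₁ π w ≤ (n : ℝ) * ε) := by
  refine ⟨fun π w hw hobj => ?_, fun π w hπ hNE hw => ⟨feasNE_of_isBRVal hP hπ hw, ?_⟩⟩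
  · have hself : ∀ k, 0 ≤ w k 0 s₁ - val H P (r k) (prodPol π) 0 s₁ := fun k => by
      have h := hw.val_deviate_le hP (hw.1 k) (Nat.zero_le H) s₁
      rw [val_congr P (r k) (fun h hh => deviate_prodPol_self (hw.1 k) hh) (Nat.zero_le H)] at h
      exact sub_nonneg.2 h
    have hεNE : IsNE H P r s₁ ε π := fun k π' hπ' => by
      have h₁ := hw.val_deviate_le hP hπ' (Nat.zero_le H) s₁
      have h₂ : w k 0 s₁ - val H P (r k) (prodPol π) 0 s₁ ≤ objNE H P r s₁ π w :=
        Finset.single_le_sum (f := fun k => w k 0 s₁ - val H P (r k) (prodPol π) 0 s₁)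
          (fun j _ => hself j) (mem_univ k)
      linarith
    refine ⟨hεNE, fun k π' hπ' => (hεNE k π' hπ').trans ?_⟩
    have hn : (1 : ℝ) ≤ n := by exact_mod_cast k.pos
    exact le_mul_of_one_le_left hε hn
  · have hk : ∀ k ∈ (univ : Finset (Fin n)),
        w k 0 s₁ - val H P (r k) (prodPol π) 0 s₁ ≤ ε := fun k _ => by
      obtain ⟨π', hπ', hv⟩ := (hw k 0 (Nat.zero_le H) s₁).1
      rw [hv]
      exact hNE k π' hπ'
    simpa [objNE] using Finset.sum_le_card_nsmul _ _ _ hk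
end

section
/- In the game Γ_ex played for two reward periods starting at state s₁ (i.e., V_{k,1}(s₁) = E[r_k(s₁, a¹) + r_k(s², a²)], where s² is the state reached after the first step), the correlated stationary policy σ is an exact (0-approximate) CCE, and V^σ_{1,1}(s₁) = V^σ_{2,1}(s₁) = 1/20. -/
open Finset

section Example

/-- States of the example game: `0 = s₁`, `1 = s₂`, `2 = s₃`. -/
abbrev Sex : Type := Fin 3

/-- Action sets of the example game: players `0` and `1` have two actions
(`0 = a₁/b₁`, `1 = a₂/b₂`), player `2` has a single action. -/
abbrev Aex : Fin 3 → Type := fun k => Fin (![2, 2, 1] k)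

/-- Reward of player 1 (index 0). -/
noncomputable def r1ex (s : Sex) (a : ∀ k, Aex k) : ℝ :=
  if s = 2 then -(1 / 2) else if (a 0).val = 0 then 1 / 20 else 0

/-- Reward of player 2 (index 1). -/
noncomputable def r2ex (s : Sex) (a : ∀ k, Aex k) : ℝ :=
  if s = 2 then -(1 / 2) else if (a 1).val = 0 then 1 / 20 else 0

/-- Rewards of the example game (the same at every time step). -/
noncomputable def rex : Fin 3 → ℕ → Sex → (∀ k, Aex k) → ℝ :=
  fun k _ s a =>
    if k = 0 then r1ex s a
    else if k = 1 then r2ex s a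
    else -(r1ex s a + r2ex s a)

/-- Transitions of the example game: from `s₁` (resp. `s₂`), the joint action
`(a₁, b₁)` leads to `s₃` and any other joint action leads to `s₂` (resp. `s₁`);
from `s₃` the game moves to `s₁` or `s₂` with probability `1/2` each. -/
noncomputable def Pex : ℕ → Sex → (∀ k, Aex k) → Sex → ℝ :=
  fun _ s a s' =>
    if s = 2 then (if s' = 2 then 0 else 1 / 2)
    else if (a 0).val = 0 ∧ (a 1).val = 0 then (if s' = 2 then 1 else 0)
    else if s = 0 then (if s' = 1 then 1 else 0)
    else (if s' = 0 then 1 else 0)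

/-- The correlated (stationary) policy `σ`: in every state, the joint actions
`(a₁, b₂)` and `(a₂, b₁)` are played with probability `1/2` each. -/
noncomputable def σex : ℕ → Sex → (∀ k, Aex k) → ℝ :=
  fun _ _ a => if (a 0).val ≠ (a 1).val then 1 / 2 else 0

/-- The deterministic policy of player 1 that always plays `a₂`. -/
noncomputable def devex : ℕ → Sex → Aex 0 → ℝ :=
  fun _ _ b => if b.val = 1 then 1 else 0

end Example

/-- The joint action of the example game in which players `0` and `1` play `x` and `y`. -/
def jointEx (x y : Fin 2) : ∀ k, Aex k
  | 0 => x
  | 1 => y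
  | 2 => (0 : Fin 1)

/-- Joint actions of the example game are pairs of actions of players `0` and `1`. -/
def jointExEquiv : Fin 2 × Fin 2 ≃ (∀ k, Aex k) where
  toFun p := jointEx p.1 p.2
  invFun a := (a 0, a 1)
  left_inv _ := rfl
  right_inv a := by
    funext k
    fin_cases k
    · rfl
    · rfl
    · exact Subsingleton.elim (α := Fin 1) _ _

theorem sum_joint_ex (f : (∀ k, Aex k) → ℝ) :
    ∑ a, f a = f (jointEx 0 0) + f (jointEx 0 1) + f (jointEx 1 0) + f (jointEx 1 1) := by
  rw [← jointExEquiv.sum_comp f, Fintype.sum_prod_type, Fin.sum_univ_two, Fin.sum_univ_two,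
    Fin.sum_univ_two, ← add_assoc]
  rfl

theorem σex_jointEx (h : ℕ) (s : Sex) (x y : Fin 2) :
    σex h s (jointEx x y) = if x ≠ y then 1 / 2 else 0 := by
  simp [σex, jointEx, Fin.val_inj]

theorem r1ex_jointEx (s : Sex) (x y : Fin 2) :
    r1ex s (jointEx x y) = if s = 2 then -(1 / 2) else if x = 0 then 1 / 20 else 0 := by
  simp [r1ex, jointEx]

theorem r2ex_jointEx (s : Sex) (x y : Fin 2) :
    r2ex s (jointEx x y) = if s = 2 then -(1 / 2) else if y = 0 then 1 / 20 else 0 := by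
  simp [r2ex, jointEx]

theorem Pex_jointEx (h : ℕ) (s s' : Sex) (x y : Fin 2) :
    Pex h s (jointEx x y) s' =
      if s = 2 then (if s' = 2 then 0 else 1 / 2)
      else if x = 0 ∧ y = 0 then (if s' = 2 then 1 else 0)
      else if s = 0 then (if s' = 1 then 1 else 0)
      else (if s' = 0 then 1 else 0) := by
  simp [Pex, jointEx]

theorem deviate_zero_jointEx (π' : ℕ → Sex → Fin 2 → ℝ) (h : ℕ) (s : Sex) (x y : Fin 2) :
    deviate (A := Aex) 0 π' σex h s (jointEx x y) = π' h s x * (1 / 2) := by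
  have hu : ∀ b : Fin 2, Function.update (jointEx x y) 0 b = jointEx b y := fun b => by
    funext k; fin_cases k <;> rfl
  change π' h s x * ∑ b : Fin 2, σex h s (Function.update (jointEx x y) 0 b) = _
  simp only [hu, σex_jointEx]
  fin_cases y <;> simp

theorem deviate_one_jointEx (π' : ℕ → Sex → Fin 2 → ℝ) (h : ℕ) (s : Sex) (x y : Fin 2) :
    deviate (A := Aex) 1 π' σex h s (jointEx x y) = π' h s y * (1 / 2) := by
  have hu : ∀ b : Fin 2, Function.update (jointEx x y) 1 b = jointEx x b := fun b => by
    funext k; fin_cases k <;> rfl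
  change π' h s y * ∑ b : Fin 2, σex h s (Function.update (jointEx x y) 1 b) = _
  simp only [hu, σex_jointEx]
  fin_cases x <;> simp

theorem deviate_two_jointEx (π' : ℕ → Sex → Fin 1 → ℝ) (h : ℕ) (s : Sex) (x y : Fin 2) :
    deviate (A := Aex) 2 π' σex h s (jointEx x y) = π' h s 0 * σex h s (jointEx x y) := by
  have hu : ∀ b : Fin 1, Function.update (jointEx x y) 2 b = jointEx x y := fun b => by
    funext k; fin_cases k
    · rfl
    · rfl
    · exact Subsingleton.elim (α := Fin 1) _ _
  change π' h s 0 * ∑ b : Fin 1, σex h s (Function.update (jointEx x y) 2 b) = _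
  simp [hu]

theorem val_zero_σex : val 2 Pex (rex 0) σex 0 (0 : Sex) = 1 / 20 := by
  simp [_root_.val, valAux, sum_joint_ex, Fin.sum_univ_three, rex, r1ex_jointEx,
    σex_jointEx, Pex_jointEx]
  norm_num

theorem val_deviate_zero (π' : ℕ → Sex → Fin 2 → ℝ) :
    val 2 Pex (rex 0) (deviate (A := Aex) 0 π' σex) 0 (0 : Sex) =
      π' 0 0 0 * (1 / 20) - π' 0 0 0 * (π' 1 2 0 + π' 1 2 1) / 4 +
        (π' 0 0 0 / 2 + π' 0 0 1) * (π' 1 1 0 / 20) := by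
  simp [_root_.val, valAux, sum_joint_ex, Fin.sum_univ_three, rex, r1ex_jointEx,
    deviate_zero_jointEx, Pex_jointEx]
  ring

theorem val_one_σex : val 2 Pex (rex 1) σex 0 (0 : Sex) = 1 / 20 := by
  simp [_root_.val, valAux, sum_joint_ex, Fin.sum_univ_three, rex, r2ex_jointEx,
    σex_jointEx, Pex_jointEx]
  norm_num

theorem val_deviate_one (π' : ℕ → Sex → Fin 2 → ℝ) :
    val 2 Pex (rex 1) (deviate (A := Aex) 1 π' σex) 0 (0 : Sex) =
      π' 0 0 0 * (1 / 20) - π' 0 0 0 * (π' 1 2 0 + π' 1 2 1) / 4 +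
        (π' 0 0 0 / 2 + π' 0 0 1) * (π' 1 1 0 / 20) := by
  simp [_root_.val, valAux, sum_joint_ex, Fin.sum_univ_three, rex, r2ex_jointEx,
    deviate_one_jointEx, Pex_jointEx]
  ring

theorem val_deviate_two {π' : ℕ → Sex → Fin 1 → ℝ} (hπ : IsPol 2 π') :
    val 2 Pex (rex 2) (deviate (A := Aex) 2 π' σex) 0 (0 : Sex) =
      val 2 Pex (rex 2) σex 0 (0 : Sex) := by
  have h0 (s : Sex) : π' 0 s 0 = 1 := by simpa using (hπ 0 (by norm_num) s).2
  have h1 (s : Sex) : π' 1 s 0 = 1 := by simpa using (hπ 1 (by norm_num) s).2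
  simp [_root_.val, valAux, sum_joint_ex, deviate_two_jointEx, h0, h1]

/-- The deviation value of players `0` and `1` never exceeds `1 / 20`. -/
theorem deviation_value_le {π' : ℕ → Sex → Fin 2 → ℝ} (hπ : IsPol 2 π') :
    π' 0 0 0 * (1 / 20) - π' 0 0 0 * (π' 1 2 0 + π' 1 2 1) / 4 +
      (π' 0 0 0 / 2 + π' 0 0 1) * (π' 1 1 0 / 20) ≤ 1 / 20 := by
  obtain ⟨hp, hp'⟩ := hπ 0 (by norm_num) 0
  obtain ⟨hq, hq'⟩ := hπ 1 (by norm_num) 1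
  have hr := (hπ 1 (by norm_num) 2).2
  rw [Fin.sum_univ_two] at hp' hq' hr
  rw [hr]
  have hc : π' 1 1 0 ≤ 1 := by linarith [hq 1]
  nlinarith [mul_le_mul_of_nonneg_left hc (by linarith [hp 0, hp 1] : 0 ≤ π' 0 0 0 / 2 + π' 0 0 1),
    hp 0]

theorem example_sigma_is_CCE_finite_horizon :
    IsCCE 2 Pex rex (0 : Sex) 0 σex ∧
    val 2 Pex (rex 0) σex 0 (0 : Sex) = 1 / 20 ∧
    val 2 Pex (rex 1) σex 0 (0 : Sex) = 1 / 20 := by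
  refine ⟨fun k π' hπ => sub_nonpos.2 ?_, val_zero_σex, val_one_σex⟩
  match k with
  | 0 => exact (val_deviate_zero π').trans_le ((deviation_value_le hπ).trans_eq val_zero_σex.symm)
  | 1 => exact (val_deviate_one π').trans_le ((deviation_value_le hπ).trans_eq val_one_σex.symm)
  | 2 => exact (val_deviate_two hπ).le
end

section
/- In the game Γ_ex played for two reward periods starting at state s₁, the marginal product policy π^σ of σ (under which players 1 and 2 each play their two actions uniformly at random in every state, independently) satisfies V^{π^σ}_{1,1}(s₁) = V^{π^σ}_{2,1}(s₁) = −13/160, while the deviation of player 1 to the deterministic policy that always plays a₂ yields value 0. Consequently, π^σ is not an ε-approximate NE for any ε < 13/160; in particular π^σ is not a Nash equilibrium. -/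
open Finset

/-- The joint action in which players 1 and 2 play `x` and `y`. -/
def jointAction (x y : Fin 2) : ∀ k, Aex k
  | 0 => x
  | 1 => y
  | 2 => (0 : Fin 1)

theorem univ_jointAction : (univ : Finset (∀ k, Aex k)) =
    {jointAction 0 0, jointAction 0 1, jointAction 1 0, jointAction 1 1} := by
  decide

theorem sum_jointAction (f : (∀ k, Aex k) → ℝ) :
    ∑ a, f a = f (jointAction 0 0) + f (jointAction 0 1) + f (jointAction 1 0) +
      f (jointAction 1 1) := by
  rw [univ_jointAction, sum_insert (by decide), sum_insert (by decide), sum_insert (by decide),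
    sum_singleton]
  ring

@[simp] theorem val_jointAction_zero (x y : Fin 2) : (jointAction x y 0).val = x.val := rfl

@[simp] theorem val_jointAction_one (x y : Fin 2) : (jointAction x y 1).val = y.val := rfl

@[simp] theorem val_jointAction_two (x y : Fin 2) : (jointAction x y 2).val = 0 := rfl

theorem marginal_σex_zero (h : ℕ) (s : Sex) (b : Aex 0) : marginal σex 0 h s b = 1 / 2 := by
  have hlt : b.val < 2 := b.isLt
  unfold marginal
  rw [sum_jointAction]
  obtain hb | hb : b.val = 0 ∨ b.val = 1 := by omega
  all_goals simp [σex, Fin.ext_iff, hb]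

theorem marginal_σex_one (h : ℕ) (s : Sex) (b : Aex 1) : marginal σex 1 h s b = 1 / 2 := by
  have hlt : b.val < 2 := b.isLt
  unfold marginal
  rw [sum_jointAction]
  obtain hb | hb : b.val = 0 ∨ b.val = 1 := by omega
  all_goals simp [σex, Fin.ext_iff, hb]

theorem marginal_σex_two (h : ℕ) (s : Sex) (b : Aex 2) : marginal σex 2 h s b = 1 := by
  have hb : b.val = 0 := Nat.lt_one_iff.mp b.isLt
  unfold marginal
  rw [sum_jointAction]
  simp [σex, Fin.ext_iff, hb]
  norm_num

theorem prodPol_marginal_σex (h : ℕ) (s : Sex) (a : ∀ k, Aex k) :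
    prodPol (fun k => marginal σex k) h s a = 1 / 4 := by
  simp only [prodPol, Fin.prod_univ_three, marginal_σex_zero, marginal_σex_one, marginal_σex_two]
  norm_num

theorem deviate_devex (h : ℕ) (s : Sex) (a : ∀ k, Aex k) :
    deviate 0 devex (prodPol fun k => marginal σex k) h s a =
      if (a 0).val = 1 then 1 / 2 else 0 := by
  simp only [deviate, prodPol_marginal_σex, devex]
  split_ifs <;> norm_num

theorem isPol_devex (H : ℕ) : IsPol H devex := by
  refine fun h _ s => ⟨fun b => ?_, ?_⟩
  · unfold devex
    split_ifs <;> norm_num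
  · change ∑ b : Fin 2, (if b.val = 1 then (1 : ℝ) else 0) = 1
    rw [Fin.sum_univ_two]
    norm_num

theorem val_rex_zero_marginal :
    val 2 Pex (rex 0) (prodPol fun k => marginal σex k) 0 (0 : Sex) = -(13 / 160) := by
  simp [_root_.val, valAux, sum_jointAction, prodPol_marginal_σex, Fin.sum_univ_three, rex,
    r1ex, Pex, -sum_const]
  norm_num

theorem val_rex_one_marginal :
    val 2 Pex (rex 1) (prodPol fun k => marginal σex k) 0 (0 : Sex) = -(13 / 160) := by
  simp [_root_.val, valAux, sum_jointAction, prodPol_marginal_σex, Fin.sum_univ_three, rex,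
    r2ex, Pex, -sum_const]
  norm_num

theorem val_deviate_devex :
    val 2 Pex (rex 0)
      (deviate 0 devex (prodPol fun k => marginal σex k)) 0 (0 : Sex) = 0 := by
  simp [_root_.val, valAux, sum_jointAction, deviate_devex, rex, r1ex, Pex]

theorem not_isNE_marginal {ε : ℝ} (hε : ε < 13 / 160) :
    ¬ IsNE 2 Pex rex (0 : Sex) ε (fun k => marginal σex k) := by
  intro hNE
  have hgain := hNE 0 devex (isPol_devex 2)
  rw [val_deviate_devex, val_rex_zero_marginal] at hgain
  linarith

theorem example_marginal_not_NE_finite_horizon :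
    val 2 Pex (rex 0) (prodPol fun k => marginal σex k) 0 (0 : Sex) = -(13 / 160) ∧
    val 2 Pex (rex 1) (prodPol fun k => marginal σex k) 0 (0 : Sex) = -(13 / 160) ∧
    val 2 Pex (rex 0)
      (deviate 0 devex (prodPol fun k => marginal σex k)) 0 (0 : Sex) = 0 ∧
    (∀ ε : ℝ, ε < 13 / 160 →
      ¬ IsNE 2 Pex rex (0 : Sex) ε (fun k => marginal σex k)) ∧
    ¬ IsNE 2 Pex rex (0 : Sex) 0 (fun k => marginal σex k) :=
  ⟨val_rex_zero_marginal, val_rex_one_marginal, val_deviate_devex,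
    fun _ hε => not_isNE_marginal hε, not_isNE_marginal (by norm_num)⟩
end

section
/- There exists a finite-horizon zero-sum polymatrix Markov game Γ (which does not satisfy the switching-control assumption: more than one player affects the transitions) together with an exact (0-approximate) CCE σ of Γ such that the marginal product policy π^σ is not a Nash equilibrium of Γ; in fact, π^σ is not an ε-approximate NE for any ε < 13/160. -/
open Finset

/-- A finite-horizon Markov game (bundled). -/
structure FHGame where
  /-- number of players -/
  n : ℕ
  /-- horizon -/
  H : ℕ
  /-- state space -/
  S : Type
  fintS : Fintype S
  /-- action spaces -/
  A : Fin n → Type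
  fintA : ∀ k, Fintype (A k)
  decA : ∀ k, DecidableEq (A k)
  /-- transition kernel -/
  P : ℕ → S → (∀ k, A k) → S → ℝ
  /-- reward functions -/
  r : Fin n → ℕ → S → (∀ k, A k) → ℝ
  /-- initial state -/
  s₁ : S

attribute [instance] FHGame.fintS FHGame.fintA FHGame.decA

namespace MiscoordinationGame

/-- The transition moves to the state `true` exactly when players `0` and `1` miscoordinate. -/
def kernel : ℕ → Bool → (Fin 3 → Bool) → Bool → ℝ :=
  fun _ _ a s' => if s' = (a 0 != a 1) then 1 else 0

/-- In the state `true`, player `2` can take `1 / 2` from each of the other players. -/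
noncomputable def reward : Fin 3 → ℕ → Bool → (Fin 3 → Bool) → ℝ :=
  fun k _ s a => if s = true ∧ a 2 = true then (if k = 2 then 1 else -1 / 2) else 0

/-- Pairwise payoffs whose sums are `reward`. -/
noncomputable def pairPayoff : Fin 3 → Fin 3 → ℕ → Bool → Bool → Bool → ℝ :=
  fun k j _ s x y =>
    if s = true then
      if k = 2 then (if x = true then 1 / 2 else 0)
      else if j = 2 ∧ y = true then -1 / 2 else 0
    else 0

/-- The three-player, horizon-two game in which players `0` and `1` control the transition together and
player `2` has a profitable action only after a miscoordination. -/
noncomputable def game : FHGame where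
  n := 3
  H := 2
  S := Bool
  fintS := inferInstance
  A := fun _ => Bool
  fintA := fun _ => inferInstance
  decA := fun _ => inferInstance
  P := kernel
  r := reward
  s₁ := false

/-- Players `0` and `1` play a uniformly random common action; player `2` plays `false`. -/
noncomputable def policy : ℕ → Bool → (Fin 3 → Bool) → ℝ :=
  fun _ _ a => if a 0 = a 1 ∧ a 2 = false then 1 / 2 else 0

lemma sum_fin_three_bool (f : (Fin 3 → Bool) → ℝ) :
    ∑ a, f a = ∑ x, ∑ y, ∑ z, f ![x, y, z] := by
  have h : (univ : Finset (Fin 3 → Bool)) =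
      (univ : Finset (Bool × Bool × Bool)).image (fun p => ![p.1, p.2.1, p.2.2]) := by decide
  rw [h, Finset.sum_image (by decide), Fintype.sum_prod_type]
  simp only [Fintype.sum_prod_type]

lemma isKernel : IsKernel (A := fun _ : Fin 3 => Bool) 2 kernel := by
  intro h _ s a
  refine ⟨fun s' => ?_, by simp [kernel]⟩
  unfold kernel
  split_ifs <;> norm_num

lemma isReward : IsReward (A := fun _ : Fin 3 => Bool) 2 reward := by
  intro k h _ s a
  unfold reward
  split_ifs <;> norm_num

lemma isZSPolymatrix : IsZSPolymatrix (A := fun _ : Fin 3 => Bool) 2 reward := by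
  refine ⟨fun h _ s a => ?_, pairPayoff, fun k j h s x y => ?_, fun k h _ s a => ?_⟩
  · simp only [reward, Fin.sum_univ_three]
    split_ifs <;> simp_all
  · unfold pairPayoff
    split_ifs <;> norm_num
  · rw [Finset.sum_filter]
    fin_cases k <;> cases s <;> cases h2 : a 2 <;>
      (simp [reward, pairPayoff, Fin.sum_univ_three, h2]; try norm_num)

lemma not_switchingControl : ¬ SwitchingControl (A := fun _ : Fin 3 => Bool) 2 kernel := by
  intro hsc
  obtain ⟨k, hk⟩ := hsc false
  fin_cases k
  · simpa [kernel] using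
      congrFun (hk 0 (by norm_num) ![false, false, false] ![false, true, false] rfl) true
  · simpa [kernel] using
      congrFun (hk 0 (by norm_num) ![false, false, false] ![true, false, false] rfl) true
  · simpa [kernel] using
      congrFun (hk 0 (by norm_num) ![false, false, false] ![true, false, false] rfl) true

lemma isPol : IsPol 2 policy := by
  intro h _ s
  refine ⟨fun a => ?_, ?_⟩
  · unfold policy
    split_ifs <;> norm_num
  · simp [sum_fin_three_bool, policy]

lemma val_policy (k : Fin 3) :
    val (A := fun _ : Fin 3 => Bool) 2 kernel (reward k) policy 0 false = 0 := by
  simp [_root_.val, valAux, sum_fin_three_bool, policy, reward, kernel]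

lemma isCCE : IsCCE (A := fun _ : Fin 3 => Bool) 2 kernel reward false 0 policy := by
  intro k π' _
  rw [val_policy, sub_zero]
  refine le_of_eq ?_
  fin_cases k <;>
    simp [_root_.val, valAux, sum_fin_three_bool, policy, reward, kernel, deviate]

lemma marginal_policy (k : Fin 3) (h : ℕ) (s b : Bool) :
    marginal (A := fun _ : Fin 3 => Bool) policy k h s b =
      if k = 2 then (if b = false then 1 else 0) else 1 / 2 := by
  fin_cases k <;> cases b <;> simp [marginal, sum_fin_three_bool, policy]

lemma prodPol_marginal (h : ℕ) (s : Bool) (a : Fin 3 → Bool) :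
    prodPol (fun k => marginal (A := fun _ : Fin 3 => Bool) policy k) h s a =
      if a 2 = false then 1 / 4 else 0 := by
  simp only [prodPol, marginal_policy, Fin.prod_univ_three]
  split_ifs <;> simp_all
  norm_num

lemma not_isNE {ε : ℝ} (hε : ε < 1 / 2) :
    ¬ IsNE (A := fun _ : Fin 3 => Bool) 2 kernel reward false ε (fun k => marginal policy k) := by
  intro hne
  have h := hne 2 (fun _ _ b => if b = true then 1 else 0) (fun _ _ _ =>
    ⟨fun b => by cases b <;> simp, by simp⟩)
  have hval : val (A := fun _ : Fin 3 => Bool) 2 kernel (reward 2)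
      (prodPol (fun k => marginal policy k)) 0 false = 0 := by
    simp [_root_.val, valAux, sum_fin_three_bool, prodPol_marginal, reward, kernel]
  have hdev : val (A := fun _ : Fin 3 => Bool) 2 kernel (reward 2)
      (deviate 2 (fun _ _ b => if b = true then 1 else 0)
        (prodPol (fun k => marginal policy k))) 0 false = 1 / 2 := by
    simp [_root_.val, valAux, sum_fin_three_bool, prodPol_marginal, reward, kernel, deviate]
    norm_num
  rw [hval, hdev] at h
  linarith

end MiscoordinationGame

theorem exists_game_cce_does_not_collapse :
    ∃ (G : FHGame) (σ : ℕ → G.S → (∀ k, G.A k) → ℝ),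
      IsKernel G.H G.P ∧ IsReward G.H G.r ∧
      IsZSPolymatrix G.H G.r ∧ ¬ SwitchingControl G.H G.P ∧
      IsPol G.H σ ∧ IsCCE G.H G.P G.r G.s₁ 0 σ ∧
      ¬ IsNE G.H G.P G.r G.s₁ 0 (fun k => marginal σ k) ∧
      ∀ ε : ℝ, ε < 13 / 160 →
        ¬ IsNE G.H G.P G.r G.s₁ ε (fun k => marginal σ k) := by
  open MiscoordinationGame in
  exact ⟨game, policy, isKernel, isReward, isZSPolymatrix, not_switchingControl, isPol, isCCE,
    not_isNE (by norm_num), fun ε hε => not_isNE (hε.trans (by norm_num))⟩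
end

section
/- Let Γ be a finite-horizon zero-sum polymatrix switching-control Markov game, let h ∈ [H], and let w : [n] × S → ℝ satisfy Σ_{k=1}^n w_k(s') = 0 for every s' ∈ S. Then for every state s, the one-shot n-player game with payoff functions u_k(a) = r_{k,h}(s, a) + Σ_{s'} P_h(s'|s, a) w_k(s') for a ∈ A is again a zero-sum polymatrix game: Σ_{k=1}^n u_k(a) = 0 for every a ∈ A, and each u_k decomposes as a sum of pairwise payoff terms, each depending on the actions of at most two players (player k and one other player). -/
open Finset

theorem one_shot_game_zero_sum_polymatrix
    {n : ℕ} {S : Type*} [Fintype S] {A : Fin n → Type*}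
    [∀ k, Fintype (A k)] [∀ k, DecidableEq (A k)]
    (H : ℕ) (P : ℕ → S → (∀ k, A k) → S → ℝ)
    (r : Fin n → ℕ → S → (∀ k, A k) → ℝ)
    (hP : IsKernel H P) (hr : IsReward H r)
    (hzs : IsZSPolymatrix H r) (hsc : SwitchingControl H P)
    (h : ℕ) (hh : h < H) (w : Fin n → S → ℝ)
    (hw : ∀ s' : S, ∑ k, w k s' = 0) (s : S) :
    (∀ a : ∀ k, A k, ∑ k, (r k h s a + ∑ s', P h s a s' * w k s') = 0) ∧
    ∃ q : (k : Fin n) → (j : Fin n) → A k → A j → ℝ,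
      ∀ (k : Fin n) (a : ∀ j, A j),
        r k h s a + ∑ s', P h s a s' * w k s' =
          ∑ j ∈ Finset.univ.filter (fun j => j ≠ k), q k j (a k) (a j) := by
  have hzero : ∀ a : ∀ k, A k, ∑ k, ∑ s', P h s a s' * w k s' = 0 := fun a => by
    rw [Finset.sum_comm]
    simp [← Finset.mul_sum, hw]
  obtain ⟨hsum, q, -, hq⟩ := hzs
  refine ⟨fun a => by rw [Finset.sum_add_distrib, hsum h hh s a, hzero a, add_zero], ?_⟩
  obtain ⟨c, hc⟩ := hsc s
  rcases isEmpty_or_nonempty (∀ k, A k) with hA | ⟨⟨a₀⟩⟩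
  · exact ⟨fun _ _ _ _ => 0, fun _ a => isEmptyElim a⟩
  -- The continuation payoff of player `k` when player `i` plays `x` and the others follow `a₀`.
  let g : Fin n → (i : Fin n) → A i → ℝ := fun k i x =>
    ∑ s', P h s (Function.update a₀ i x) s' * w k s'
  have hg : ∀ (k : Fin n) (a : ∀ j, A j), ∑ s', P h s a s' * w k s' = g k c (a c) :=
    fun k a => by
      simp only [g]
      rw [hc h hh a (Function.update a₀ c (a c)) (by simp)]
  refine ⟨fun k j x y => q k j h s x y +
    if j = c then g k j y else if k = c then -g j k x else 0, fun k a => ?_⟩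
  rw [Finset.sum_add_distrib, hq k h hh s a, hg]
  congr 1
  by_cases hk : k = c
  · subst hk
    have hz := hzero a
    simp only [hg] at hz
    rw [← Finset.add_sum_erase _ _ (Finset.mem_univ k)] at hz
    rw [Finset.filter_ne', eq_neg_of_add_eq_zero_left hz, ← Finset.sum_neg_distrib]
    refine Finset.sum_congr rfl fun j hj => ?_
    simp [Finset.ne_of_mem_erase hj]
  · simp [hk, Ne.symm hk, Finset.sum_ite_eq']
end
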